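/- Suboptimality of UKF for linear systems (Proposition 1, covariance mismatch): if Q·Cᵀ ≠ 0, then P_z^UKF ≠ C·P_prior·Cᵀ + R and P_ez^UKF ≠ P_prior·Cᵀ; that is, the UKF output-error covariance and cross-covariance differ from the exact (Kalman-filter) covariances. -/

import Mathlib

open Matrix

/-- UKF weight vector `W ∈ ℝ^{2n+1}`. -/
noncomputable def ukfW (n : ℕ) (α : ℝ) : Fin (2*n+1) → ℝ :=
  fun i => if i.val = 0 then (α^2 - 1)/α^2 else 1/(2*α^2*n)

/-- Perturbation matrix `Δ(α, B)`: first column 0, next n columns `α·bᵢ`,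
last n columns `−α·bᵢ`. -/
noncomputable def ukfDelta (n : ℕ) (α : ℝ) (B : Matrix (Fin n) (Fin n) ℝ) :
    Matrix (Fin n) (Fin (2*n+1)) ℝ :=
  Matrix.of fun i j =>
    if h0 : j.val = 0 then 0
    else if h1 : j.val ≤ n then α * B i ⟨j.val - 1, by omega⟩
    else -(α * B i ⟨j.val - n - 1, by have := j.isLt; omega⟩)

/-- Sigma-point matrix `X(x̂, α, B)`: j-th column is `x̂` plus the j-th column of `Δ(α, B)`. -/
noncomputable def sigmaPts {n : ℕ} (xhat : Fin n → ℝ) (α : ℝ)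
    (B : Matrix (Fin n) (Fin n) ℝ) : Matrix (Fin n) (Fin (2*n+1)) ℝ :=
  Matrix.of fun i j => xhat i + ukfDelta n α B i j

/-- Affine propagation of an ensemble: j-th column of the result is `A·(j-th column of X) + u`. -/
noncomputable def propagate {n : ℕ} (A : Matrix (Fin n) (Fin n) ℝ) (u : Fin n → ℝ)
    (X : Matrix (Fin n) (Fin (2*n+1)) ℝ) : Matrix (Fin n) (Fin (2*n+1)) ℝ :=
  Matrix.of fun i j => A.mulVec (fun r => X r j) i + u i

/-- Deviation matrix `X̃ = X − (X·W)·1ᵀ`. -/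
noncomputable def devMat {q m : ℕ} (w : Fin m → ℝ) (X : Matrix (Fin q) (Fin m) ℝ) :
    Matrix (Fin q) (Fin m) ℝ :=
  X - Matrix.vecMulVec (X.mulVec w) (fun _ => 1)

/-- Posterior covariance as a function of the gain:
`P(K̂) = P_prior + K̂·R̄·K̂ᵀ − K̂·C·P_prior − P_prior·Cᵀ·K̂ᵀ`. -/
noncomputable def postCov {n p : ℕ} (Pprior : Matrix (Fin n) (Fin n) ℝ)
    (C : Matrix (Fin p) (Fin n) ℝ) (Rbar : Matrix (Fin p) (Fin p) ℝ)
    (K : Matrix (Fin n) (Fin p) ℝ) : Matrix (Fin n) (Fin n) ℝ :=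
  Pprior + K * Rbar * Kᵀ - K * C * Pprior - Pprior * Cᵀ * Kᵀ

theorem sum_fin_two_mul_add_one {n : ℕ} (f : Fin (2*n+1) → ℝ) :
    ∑ j, f j = f 0 + ∑ i : Fin n, (f ⟨i.val + 1, by omega⟩ + f ⟨n + i.val + 1, by omega⟩) := by
  rw [Fin.sum_univ_succ, Finset.sum_add_distrib,
    ← Equiv.sum_comp (finCongr (two_mul n).symm), Fin.sum_univ_add]
  rfl

theorem ukfW_zero (n : ℕ) (α : ℝ) : ukfW n α 0 = (α^2 - 1)/α^2 := by
  simp [ukfW]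

theorem ukfW_succ (n : ℕ) (α : ℝ) (k : ℕ) (hk : k + 1 < 2*n+1) :
    ukfW n α ⟨k + 1, hk⟩ = 1/(2*α^2*n) := by
  simp [ukfW]

theorem ukfDelta_zero (n : ℕ) (α : ℝ) (B : Matrix (Fin n) (Fin n) ℝ) (i : Fin n) :
    ukfDelta n α B i 0 = 0 := by
  simp [ukfDelta]

theorem ukfDelta_left (n : ℕ) (α : ℝ) (B : Matrix (Fin n) (Fin n) ℝ) (i k : Fin n)
    (hk : k.val + 1 < 2*n+1) : ukfDelta n α B i ⟨k.val + 1, hk⟩ = α * B i k := by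
  have h : k.val + 1 ≤ n := k.isLt
  simp [ukfDelta, h]

theorem ukfDelta_right (n : ℕ) (α : ℝ) (B : Matrix (Fin n) (Fin n) ℝ) (i k : Fin n)
    (hk : n + k.val + 1 < 2*n+1) : ukfDelta n α B i ⟨n + k.val + 1, hk⟩ = -(α * B i k) := by
  have h : ¬ n + k.val + 1 ≤ n := by omega
  have h' : n + k.val + 1 - n - 1 = k.val := by omega
  simp [ukfDelta, h, h']

theorem sum_ukfW {n : ℕ} (hn : 0 < n) {α : ℝ} (hα : α ≠ 0) : ∑ j, ukfW n α j = 1 := by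
  have hn' : (n : ℝ) ≠ 0 := by exact_mod_cast hn.ne'
  rw [sum_fin_two_mul_add_one]
  simp only [ukfW_zero, ukfW_succ, Finset.sum_const, Finset.card_univ, Fintype.card_fin,
    nsmul_eq_mul]
  field_simp
  ring

theorem ukfDelta_mulVec_ukfW (n : ℕ) (α : ℝ) (B : Matrix (Fin n) (Fin n) ℝ) :
    ukfDelta n α B *ᵥ ukfW n α = 0 := by
  ext i
  simp only [mulVec, dotProduct, sum_fin_two_mul_add_one, ukfDelta_zero, ukfDelta_left,
    ukfDelta_right, ukfW_succ]
  simp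

theorem ukfDelta_mul_diagonal_mul_transpose {n : ℕ} (hn : 0 < n) {α : ℝ} (hα : α ≠ 0)
    {B P : Matrix (Fin n) (Fin n) ℝ} (hB : B * Bᵀ = (n : ℝ) • P) :
    ukfDelta n α B * diagonal (ukfW n α) * (ukfDelta n α B)ᵀ = P := by
  have hn' : (n : ℝ) ≠ 0 := by exact_mod_cast hn.ne'
  ext i k
  have h : ∑ j, B i j * B k j = n * P i k := by
    simpa [mul_apply] using congrFun (congrFun hB i) k
  rw [mul_apply]
  simp only [mul_diagonal, transpose_apply, sum_fin_two_mul_add_one, ukfDelta_zero,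
    ukfDelta_left, ukfDelta_right, ukfW_succ]
  have h2 : ∀ j, α * B i j * (1/(2*α^2*n)) * (α * B k j) +
      -(α * B i j) * (1/(2*α^2*n)) * -(α * B k j) = (1/(n : ℝ)) * (B i j * B k j) := by
    intro j
    field_simp
    ring
  simp only [h2, ← Finset.mul_sum, h]
  field_simp
  ring

theorem devMat_mul_add_vecMulVec_one {q n m : ℕ} {w : Fin m → ℝ} (hw : ∑ j, w j = 1)
    (M : Matrix (Fin q) (Fin n) ℝ) {D : Matrix (Fin n) (Fin m) ℝ} (hD : D *ᵥ w = 0)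
    (c : Fin q → ℝ) :
    devMat w (M * D + vecMulVec c fun _ => 1) = M * D := by
  have h : (M * D + vecMulVec c fun _ => 1) *ᵥ w = c := by
    rw [add_mulVec, ← mulVec_mulVec, hD, mulVec_zero, zero_add]
    ext i
    simp [mulVec, dotProduct, vecMulVec_apply, ← Finset.mul_sum, hw]
  rw [devMat, h, add_sub_cancel_right]

theorem propagate_sigmaPts {n : ℕ} (A : Matrix (Fin n) (Fin n) ℝ) (u xhat : Fin n → ℝ) (α : ℝ)
    (B : Matrix (Fin n) (Fin n) ℝ) :
    propagate A u (sigmaPts xhat α B) =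
      A * ukfDelta n α B + vecMulVec (A *ᵥ xhat + u) fun _ => 1 := by
  ext i j
  simp only [propagate, sigmaPts, of_apply, mulVec, dotProduct, Matrix.add_apply, mul_apply,
    vecMulVec_apply, Pi.add_apply, mul_add, Finset.sum_add_distrib]
  ring

theorem Matrix.PosSemidef.mul_eq_zero_of_transpose_mul_mul_eq_zero {n p : ℕ}
    {Q : Matrix (Fin n) (Fin n) ℝ} (hQ : Q.PosSemidef) {M : Matrix (Fin n) (Fin p) ℝ}
    (h : Mᵀ * Q * M = 0) : Q * M = 0 := by
  ext i j
  have hj : M.col j ⬝ᵥ Q *ᵥ M.col j = 0 := by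
    have := congrFun (congrFun h j) j
    rw [Matrix.mul_assoc] at this
    exact this
  have := (hQ.dotProduct_mulVec_zero_iff (M.col j)).mp (by simpa using hj)
  exact congrFun this i

theorem stmt12 {n p : ℕ} (hn : 0 < n) (hp : 0 < p)
    (A : Matrix (Fin n) (Fin n) ℝ) (C : Matrix (Fin p) (Fin n) ℝ)
    (Q P : Matrix (Fin n) (Fin n) ℝ) (R : Matrix (Fin p) (Fin p) ℝ)
    (hQ : Q.PosSemidef) (hR : R.PosDef) (hP : P.PosSemidef)
    (xhat u : Fin n → ℝ) (α : ℝ) (hα : α ≠ 0)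
    (B : Matrix (Fin n) (Fin n) ℝ) (hB : B * Bᵀ = (n : ℝ) • P)
    (X' : Matrix (Fin n) (Fin (2*n+1)) ℝ) (hX' : X' = propagate A u (sigmaPts xhat α B))
    (Xt : Matrix (Fin n) (Fin (2*n+1)) ℝ) (hXt : Xt = devMat (ukfW n α) X')
    (Yt : Matrix (Fin p) (Fin (2*n+1)) ℝ) (hYt : Yt = devMat (ukfW n α) (C * X'))
    (hQC : Q * Cᵀ ≠ 0) :
    Yt * Matrix.diagonal (ukfW n α) * Ytᵀ + R ≠ C * (A * P * Aᵀ + Q) * Cᵀ + R ∧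
    Xt * Matrix.diagonal (ukfW n α) * Ytᵀ ≠ (A * P * Aᵀ + Q) * Cᵀ := by
  have hX : Xt = A * ukfDelta n α B := by
    rw [hXt, hX', propagate_sigmaPts,
      devMat_mul_add_vecMulVec_one (sum_ukfW hn hα) A (ukfDelta_mulVec_ukfW n α B)]
  have hY : Yt = C * A * ukfDelta n α B := by
    rw [hYt, hX', propagate_sigmaPts, Matrix.mul_add, ← Matrix.mul_assoc, mul_vecMulVec,
      devMat_mul_add_vecMulVec_one (sum_ukfW hn hα) (C * A) (ukfDelta_mulVec_ukfW n α B)]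
  have hcross : Xt * diagonal (ukfW n α) * Ytᵀ = A * P * Aᵀ * Cᵀ := by
    rw [← ukfDelta_mul_diagonal_mul_transpose hn hα hB, hX, hY]
    simp only [transpose_mul, Matrix.mul_assoc]
  have hout : Yt * diagonal (ukfW n α) * Ytᵀ = C * (A * P * Aᵀ) * Cᵀ := by
    rw [Matrix.mul_assoc C, ← hcross, hX, hY]
    simp only [Matrix.mul_assoc]
  refine ⟨fun h => hQC ?_, fun h => hQC ?_⟩
  · rw [hout, add_left_inj, Matrix.mul_add, Matrix.add_mul, left_eq_add] at h
    exact hQ.mul_eq_zero_of_transpose_mul_mul_eq_zero (by rwa [transpose_transpose])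
  · rwa [hcross, Matrix.add_mul, left_eq_add] at h
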